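/- Let μ be a probability measure on ℝ with characteristic function φ(t) = U(t) + iV(t), intermediate distribution function F, and tail difference K(x) = 1 − F(x) − F(−x) for x > 0. Let 0 < k < 2 with k ≠ 1. Suppose: (a) there is δ > 0 such that V is nonvanishing and of constant sign on (0, δ), and V(λt)/V(t) → λ^k as t ↓ 0 for every λ > 0 (V is regularly varying at 0 with index k); and (b) K is monotone on (x₀, ∞) for some x₀ > 0. Then K(x)·C(k)/V(1/x) → 1 as x → ∞, where C(k) = Γ(1−k) sin(πk/2); that is, K(x) ~ V(1/x)/C(k) as x → ∞. -/

import Mathlib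

open MeasureTheory Complex Filter

/-- The characteristic function of a measure on ℝ. -/
noncomputable def charFun' (μ : Measure ℝ) (t : ℝ) : ℂ :=
  ∫ x, Complex.exp (Complex.I * t * x) ∂μ

/-- The intermediate distribution function `F(x) = (μ(-∞,x) + μ(-∞,x])/2`. -/
noncomputable def interDF (μ : Measure ℝ) (x : ℝ) : ℝ :=
  ((μ (Set.Iio x)).toReal + (μ (Set.Iic x)).toReal) / 2

/-- The tail difference `K(x) = 1 - F(x) - F(-x)`. -/
noncomputable def tailDiff (μ : Measure ℝ) (x : ℝ) : ℝ :=
  1 - interDF μ x - interDF μ (-x)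

/-- Uniform (Potter-type) bound for a continuous function whose increments converge. -/
lemma exists_abs_increment_le {f : ℝ → ℝ} {k ε : ℝ} (hf : Continuous f) (hε : 0 < ε)
    (h : ∀ u, Tendsto (fun s => f (s + u) - f s) atTop (nhds (-(k * u)))) :
    ∃ S C : ℝ, ∀ s ≥ S, ∀ u ≥ 0, |f (s + u) - f s + k * u| ≤ ε * u + C := by
  let E : ℕ → Set ℝ := fun n => {u | ∀ s ≥ (n : ℝ), |f (s + u) - f s + k * u| ≤ 1}
  have h0 : ∀ u, ∀ e > 0, ∃ N : ℝ, ∀ s ≥ N, |f (s + u) - f s + k * u| ≤ e := by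
    intro u e he
    obtain ⟨N, hN⟩ := Metric.tendsto_atTop.1 (h u) e he
    refine ⟨N, fun s hs => ?_⟩
    have := (hN s hs).le
    rwa [Real.dist_eq, sub_neg_eq_add] at this
  have hclosed : ∀ n, IsClosed (E n) := by
    intro n
    have : E n = ⋂ s : ℝ, ⋂ _ : s ≥ (n : ℝ), {u | |f (s + u) - f s + k * u| ≤ 1} := by
      ext u; simp [E]
    rw [this]
    refine isClosed_iInter fun s => isClosed_iInter fun _ => isClosed_le ?_ continuous_const
    fun_prop
  have hunion : ⋃ n, E n = Set.univ := by
    refine Set.eq_univ_of_forall fun u => Set.mem_iUnion.2 ?_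
    obtain ⟨N, hN⟩ := h0 u 1 one_pos
    obtain ⟨n, hn⟩ := exists_nat_ge N
    exact ⟨n, fun s hs => hN s (hn.trans hs)⟩
  obtain ⟨n, p, hp⟩ := nonempty_interior_of_iUnion_of_closed hclosed hunion
  obtain ⟨ρ, hρ, hball⟩ := Metric.isOpen_iff.1 isOpen_interior p hp
  set r := ρ / 2 with hr
  have hr0 : 0 < r := by positivity
  have hloc : ∀ s ≥ (n : ℝ) + p, ∀ u, 0 ≤ u → u ≤ r → |f (s + u) - f s + k * u| ≤ 2 := by
    intro s hs u hu0 hu1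
    have hm : ∀ v, 0 ≤ v → v ≤ r → p + v ∈ E n := fun v hv0 hv1 => interior_subset <| hball <| by
      rw [Metric.mem_ball, Real.dist_eq, add_sub_cancel_left, abs_of_nonneg hv0]; linarith
    have h1 := hm u hu0 hu1 (s - p) (by linarith)
    have h2 := hm 0 le_rfl hr0.le (s - p) (by linarith)
    rw [show s - p + (p + u) = s + u by ring] at h1
    rw [show s - p + (p + 0) = s by ring] at h2
    rw [abs_le] at h1 h2 ⊢
    constructor <;> linarith [h1.1, h1.2, h2.1, h2.2]
  obtain ⟨N, hN⟩ := h0 r (ε * r) (by positivity)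
  have hstep : ∀ m : ℕ, ∀ s ≥ max N (n + p),
      |f (s + m * r) - f s + k * (m * r)| ≤ ε * (m * r) := by
    intro m
    induction m with
    | zero => intro s _; simp
    | succ m ih =>
      intro s hs
      have h1 := ih s hs
      have h2 := hN (s + m * r) ((le_max_left _ _).trans
        (hs.le.trans (le_add_of_nonneg_right (by positivity))))
      rw [show s + m * r + r = s + ((m + 1 : ℕ) : ℝ) * r by push_cast; ring] at h2
      push_cast at h2 ⊢
      rw [abs_le] at h1 h2 ⊢
      constructor <;> linarith [h1.1, h1.2, h2.1, h2.2]
  refine ⟨max N (n + p), 2, fun s hs u hu => ?_⟩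
  set m := ⌊u / r⌋₊
  have hm1 : (m : ℝ) * r ≤ u := by
    rw [← le_div_iff₀ hr0]; exact Nat.floor_le (by positivity)
  have hm2 : u ≤ m * r + r := by
    have := (Nat.lt_floor_add_one (u / r)).le
    rw [div_le_iff₀ hr0] at this; linarith
  have h1 := hstep m s hs
  have h2 := hloc (s + m * r) ((le_max_right _ _).trans
        (hs.le.trans (le_add_of_nonneg_right (by positivity)))) (u - m * r)
        (by linarith) (by linarith)
  rw [show s + m * r + (u - m * r) = s + u by ring] at h2
  have h3 : ε * (m * r) ≤ ε * u := by gcongr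
  rw [abs_le] at h1 h2 ⊢
  constructor <;> linarith [h1.1, h1.2, h2.1, h2.2]

/-- Potter bound for a bounded continuous function regularly varying at `0`. -/
lemma exists_potter_bound {v : ℝ → ℝ} {k ε δ : ℝ} (hv : Continuous v) (hb : ∀ t, |v t| ≤ 1)
    (hδ : 0 < δ) (hne : ∀ t ∈ Set.Ioo 0 δ, v t ≠ 0) (hk : 0 < k) (hε : 0 < ε)
    (hrv : ∀ l : ℝ, 0 < l →
      Tendsto (fun t => v (l * t) / v t) (nhdsWithin 0 (Set.Ioi 0)) (nhds (l ^ k))) :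
    ∃ t₀ > 0, t₀ < δ ∧ ∃ C ≥ 0, ∀ τ ∈ Set.Ioc 0 t₀, ∀ t > 0,
      |v (t * τ)| ≤ C * |v τ| * (t ^ (k - ε) + t ^ (k + ε)) := by
  set a := 1 - Real.log δ with ha
  have hpos : ∀ s, a ≤ s → Real.exp (-s) ∈ Set.Ioo 0 δ := by
    intro s hs
    refine ⟨Real.exp_pos _, ?_⟩
    rw [← Real.lt_log_iff_exp_lt hδ]; linarith
  set f : ℝ → ℝ := fun s => Real.log |v (Real.exp (-(max s a)))| with hfdef
  have hf : Continuous f := by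
    refine Continuous.log (by fun_prop) fun s => ?_
    exact abs_ne_zero.2 (hne _ (hpos _ (le_max_right _ _)))
  have hfeq : ∀ s, a ≤ s → f s = Real.log |v (Real.exp (-s))| := fun s hs => by
    simp only [hfdef, max_eq_left hs]
  have hexp : Tendsto (fun s : ℝ => Real.exp (-s)) atTop (nhdsWithin 0 (Set.Ioi 0)) :=
    tendsto_nhdsWithin_iff.2 ⟨Real.tendsto_exp_neg_atTop_nhds_zero,
      Eventually.of_forall fun s => Real.exp_pos _⟩
  have hinc : ∀ u, Tendsto (fun s => f (s + u) - f s) atTop (nhds (-(k * u))) := by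
    intro u
    have h1 := (hrv (Real.exp (-u)) (Real.exp_pos _)).comp hexp
    have hlim : Real.exp (-u) ^ k ≠ 0 := (Real.rpow_pos_of_pos (Real.exp_pos _) _).ne'
    have h2 := h1.log hlim
    rw [Real.log_rpow (Real.exp_pos _), Real.log_exp, mul_neg] at h2
    refine h2.congr' ?_
    filter_upwards [eventually_ge_atTop a, eventually_ge_atTop (a - u)] with s hs hs2
    have hs3 : a ≤ s + u := by linarith
    rw [hfeq s hs, hfeq _ hs3, Function.comp_apply, ← Real.exp_add,
      ← Real.log_div (abs_ne_zero.2 (hne _ (hpos _ hs3))) (abs_ne_zero.2 (hne _ (hpos _ hs))),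
      ← abs_div, Real.log_abs, show -u + -s = -(s + u) by ring]
  obtain ⟨S, C, hSC⟩ := exists_abs_increment_le hf hε hinc
  set S' := max S a with hS'
  have hS'S : S ≤ S' := le_max_left _ _
  have hS'a : a ≤ S' := le_max_right _ _
  set t₀ := Real.exp (-S') with ht₀
  have ht₀p := hpos S' hS'a
  have key : ∀ σ ∈ Set.Ioc 0 t₀, ∀ r ∈ Set.Ioc (0 : ℝ) 1,
      |v (r * σ)| ≤ Real.exp C * |v σ| * r ^ (k - ε) ∧
      |v σ| * r ^ (k + ε) ≤ Real.exp C * |v (r * σ)| := by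
    intro σ hσ r hr
    have hs : S' ≤ -Real.log σ := by
      have := Real.log_le_log hσ.1 hσ.2
      rw [ht₀, Real.log_exp] at this; linarith
    have hu : 0 ≤ -Real.log r := neg_nonneg.2 (Real.log_nonpos hr.1.le hr.2)
    have h1 := hSC (-Real.log σ) (hS'S.trans hs) _ hu
    have hσe : Real.exp (-(-Real.log σ)) = σ := by rw [neg_neg, Real.exp_log hσ.1]
    have hre : Real.exp (-(-Real.log σ + -Real.log r)) = r * σ := by
      rw [neg_add, neg_neg, neg_neg, Real.exp_add, Real.exp_log hσ.1, Real.exp_log hr.1, mul_comm]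
    have hn1 := hne _ (hpos _ (hS'a.trans hs))
    have hn2 := hne _ (hpos (-Real.log σ + -Real.log r) (by linarith))
    rw [hfeq _ (by linarith), hfeq _ (by linarith), hσe, hre, abs_le] at h1
    rw [hσe] at hn1
    rw [hre] at hn2
    have hp1 := abs_pos.2 hn1
    have hp2 := abs_pos.2 hn2
    have e1 : |v σ| = Real.exp (Real.log |v σ|) := (Real.exp_log hp1).symm
    have e2 : |v (r * σ)| = Real.exp (Real.log |v (r * σ)|) := (Real.exp_log hp2).symm
    rw [Real.rpow_def_of_pos hr.1, Real.rpow_def_of_pos hr.1, e1, e2]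
    simp only [← Real.exp_add, Real.exp_le_exp]
    constructor <;> nlinarith [h1.1, h1.2]
  have hvt₀ : 0 < |v t₀| := abs_pos.2 (hne _ ht₀p)
  refine ⟨t₀, ht₀p.1, ht₀p.2, Real.exp C * (1 + 1 / |v t₀|), by positivity, ?_⟩
  intro τ hτ t ht
  have hp1 : 0 ≤ t ^ (k - ε) := Real.rpow_nonneg ht.le _
  have hp2 : 0 ≤ t ^ (k + ε) := Real.rpow_nonneg ht.le _
  have hCge : Real.exp C ≤ Real.exp C * (1 + 1 / |v t₀|) := by
    have : (0:ℝ) ≤ 1 / |v t₀| := by positivity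
    nlinarith [Real.exp_pos C]
  have hCge2 : Real.exp C / |v t₀| ≤ Real.exp C * (1 + 1 / |v t₀|) := by
    rw [mul_add, mul_one_div]; linarith [Real.exp_pos C]
  rcases le_total t 1 with h1 | h1
  · calc |v (t * τ)| ≤ Real.exp C * |v τ| * t ^ (k - ε) := (key τ hτ t ⟨ht, h1⟩).1
      _ ≤ _ := by gcongr; linarith
  · have hkey : ∀ σ ∈ Set.Ioc 0 t₀, τ ≤ σ →
        |v σ| ≤ Real.exp C * |v τ| * (σ / τ) ^ (k + ε) := by
      intro σ hσ hle
      have h2 := (key σ hσ (τ / σ) ⟨div_pos hτ.1 hσ.1, (div_le_one hσ.1).2 hle⟩).2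
      rw [div_mul_cancel₀ _ hσ.1.ne', ← inv_div, Real.inv_rpow (div_pos hσ.1 hτ.1).le,
        ← div_eq_mul_inv, div_le_iff₀ (Real.rpow_pos_of_pos (div_pos hσ.1 hτ.1) _)] at h2
      exact h2
    rcases le_total (t * τ) t₀ with h2 | h2
    · have h3 := hkey (t * τ) ⟨mul_pos ht hτ.1, h2⟩ (le_mul_of_one_le_left hτ.1.le h1)
      rw [mul_div_cancel_right₀ _ hτ.1.ne'] at h3
      refine h3.trans ?_
      gcongr
      linarith
    · have h3 := hkey t₀ ⟨ht₀p.1, le_rfl⟩ hτ.2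
      have hkε : 1 ≤ Real.exp C / |v t₀| * |v τ| * (t₀ / τ) ^ (k + ε) := by
        rw [div_mul_eq_mul_div, div_mul_eq_mul_div, le_div_iff₀ hvt₀]; linarith
      have hle : t₀ / τ ≤ t := (div_le_iff₀ hτ.1).2 h2
      have h0 : 0 ≤ t₀ / τ := (div_pos ht₀p.1 hτ.1).le
      calc |v (t * τ)| ≤ 1 := hb _
        _ ≤ Real.exp C / |v t₀| * |v τ| * (t₀ / τ) ^ (k + ε) := hkε
        _ ≤ Real.exp C / |v t₀| * |v τ| * t ^ (k + ε) := by gcongr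
        _ ≤ _ := by gcongr; linarith

/-- Tonelli for the Laplace transform: `∫ p(t) t⁻ʳ = Γ(r)⁻¹ ∫ s^(r-1) L(s)` for nonnegative `p`. -/
lemma integral_mul_rpow_neg_eq_laplace {p L : ℝ → ℝ} {r : ℝ} (hr : 0 < r) (hp : Continuous p)
    (hp0 : ∀ t > 0, 0 ≤ p t)
    (hint : ∀ s > 0, IntegrableOn (fun t => p t * Real.exp (-(s * t))) (Set.Ioi 0))
    (hL : ∀ s > 0, ∫ t in Set.Ioi 0, p t * Real.exp (-(s * t)) = L s)
    (hLint : IntegrableOn (fun s => s ^ (r - 1) * L s) (Set.Ioi 0)) :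
    IntegrableOn (fun t => p t * t ^ (-r)) (Set.Ioi 0) ∧
      ∫ t in Set.Ioi 0, p t * t ^ (-r) =
        (Real.Gamma r)⁻¹ * ∫ s in Set.Ioi 0, s ^ (r - 1) * L s := by
  set ν : Measure ℝ := volume.restrict (Set.Ioi 0) with hν
  set f : ℝ → ℝ → ℝ := fun s t => s ^ (r - 1) * (p t * Real.exp (-(s * t))) with hf
  have hpos : ∀ᵐ s ∂ν, 0 < s := ae_restrict_mem measurableSet_Ioi
  have hmeas : AEStronglyMeasurable (Function.uncurry f) (ν.prod ν) := by
    refine Measurable.aestronglyMeasurable ?_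
    have := hp.measurable
    simp only [hf, Function.uncurry_def]
    fun_prop
  have hfint : Integrable (Function.uncurry f) (ν.prod ν) := by
    rw [integrable_prod_iff hmeas]
    refine ⟨?_, ?_⟩
    · filter_upwards [hpos] with s hs
      simpa only [hf, Function.uncurry_apply_pair] using (hint s hs).const_mul (s ^ (r - 1))
    · refine hLint.congr ?_
      filter_upwards [hpos] with s hs
      rw [← hL s hs, ← integral_const_mul]
      refine integral_congr_ae ?_
      filter_upwards [hpos] with t ht
      rw [Function.uncurry_apply_pair, Real.norm_of_nonneg]
      exact mul_nonneg (Real.rpow_nonneg hs.le _) (mul_nonneg (hp0 t ht) (Real.exp_pos _).le)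
  have hinner : ∀ t > 0, ∫ s, f s t ∂ν = Real.Gamma r * (p t * t ^ (-r)) := by
    intro t ht
    have := Real.integral_rpow_mul_exp_neg_mul_Ioi hr ht
    calc ∫ s, f s t ∂ν = ∫ s, p t * (s ^ (r - 1) * Real.exp (-(t * s))) ∂ν := by
          congr 1; ext s; simp only [hf]; rw [mul_comm s t]; ring
      _ = _ := by
          rw [integral_const_mul, this, one_div, Real.inv_rpow ht.le, Real.rpow_neg ht.le]; ring
  have hG := Real.Gamma_pos_of_pos hr
  have h1 : Integrable (fun t => Real.Gamma r * (p t * t ^ (-r))) ν := by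
    refine hfint.integral_prod_right.congr ?_
    filter_upwards [hpos] with t ht using hinner t ht
  refine ⟨?_, ?_⟩
  · refine (h1.const_mul (Real.Gamma r)⁻¹).congr (Eventually.of_forall fun t => ?_)
    simp only []
    rw [inv_mul_cancel_left₀ hG.ne']
  · have h2 := integral_integral_swap hfint
    have h3 : ∫ s, ∫ t, f s t ∂ν ∂ν = ∫ s, s ^ (r - 1) * L s ∂ν := by
      refine integral_congr_ae ?_
      filter_upwards [hpos] with s hs
      rw [← hL s hs, ← integral_const_mul]
    have h4 : ∫ t, ∫ s, f s t ∂ν ∂ν = ∫ t, Real.Gamma r * (p t * t ^ (-r)) ∂ν := by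
      refine integral_congr_ae ?_
      filter_upwards [hpos] with t ht using hinner t ht
    rw [h3, h4, integral_const_mul] at h2
    rw [h2, inv_mul_cancel_left₀ hG.ne']

lemma integral_rpow_div_one_add {a : ℝ} (ha : 0 < a) (ha1 : a < 1) :
    IntegrableOn (fun v : ℝ => v ^ (a - 1) * (1 + v)⁻¹) (Set.Ioi 0) ∧
      ∫ v in Set.Ioi (0 : ℝ), v ^ (a - 1) * (1 + v)⁻¹ = Real.pi / Real.sin (Real.pi * a) := by
  have hint : IntegrableOn (fun v : ℝ => v ^ (a - 1) * (1 + v)⁻¹) (Set.Ioi 0) := by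
    have hm : Measurable fun v : ℝ => v ^ (a - 1) * (1 + v)⁻¹ := by fun_prop
    rw [← Set.Ioc_union_Ioi_eq_Ioi zero_le_one]
    refine IntegrableOn.union ?_ ?_
    · have h1 : IntegrableOn (fun v : ℝ => v ^ (a - 1)) (Set.Ioc 0 1) :=
        (intervalIntegrable_iff_integrableOn_Ioc_of_le zero_le_one).1
          (intervalIntegral.intervalIntegrable_rpow' (by linarith))
      refine Integrable.mono' h1 hm.aestronglyMeasurable ?_
      filter_upwards [ae_restrict_mem measurableSet_Ioc] with v hv
      have : 0 ≤ v ^ (a - 1) := Real.rpow_nonneg hv.1.le _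
      have hv0 := hv.1
      rw [Real.norm_of_nonneg (by positivity)]
      exact mul_le_of_le_one_right this (inv_le_one_of_one_le₀ (by linarith))
    · have h1 : IntegrableOn (fun v : ℝ => v ^ (a - 2)) (Set.Ioi 1) :=
        integrableOn_Ioi_rpow_of_lt (by linarith) one_pos
      refine Integrable.mono' h1 hm.aestronglyMeasurable ?_
      filter_upwards [ae_restrict_mem measurableSet_Ioi] with v hv
      have hv0 : 0 < v := zero_lt_one.trans hv
      have : 0 ≤ v ^ (a - 1) := Real.rpow_nonneg hv0.le _
      rw [Real.norm_of_nonneg (by positivity), show a - 2 = a - 1 - 1 by ring,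
        Real.rpow_sub_one hv0.ne' (a - 1), div_eq_mul_inv]
      exact mul_le_mul_of_nonneg_left (inv_anti₀ hv0 (by linarith)) this
  refine ⟨hint, ?_⟩
  have h := integral_mul_rpow_neg_eq_laplace (p := fun t => Real.exp (-t))
    (L := fun v => (1 + v)⁻¹) ha (by fun_prop) (fun t _ => (Real.exp_pos _).le) ?_ ?_ hint
  · have hG := Real.Gamma_pos_of_pos ha
    have h2 := h.2
    rw [eq_inv_mul_iff_mul_eq₀ hG.ne'] at h2
    rw [← h2, ← Real.Gamma_mul_Gamma_one_sub, Real.Gamma_eq_integral (s := 1 - a) (by linarith)]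
    congr 1
    refine integral_congr_ae (Eventually.of_forall fun t => ?_)
    simp only [sub_sub_cancel_left]
  · intro s hs
    have := integrableOn_exp_mul_Ioi (a := -(1 + s)) (by linarith) 0
    refine this.congr_fun (fun t _ => ?_) measurableSet_Ioi
    simp only [← Real.exp_add]; congr 1; ring
  · intro s hs
    have := integral_exp_mul_Ioi (a := -(1 + s)) (by linarith) 0
    rw [mul_zero, Real.exp_zero, neg_div_neg_eq, one_div] at this
    rw [← this]
    congr 1; ext t
    rw [← Real.exp_add]; congr 1; ring

lemma integral_rpow_div_one_add_sq {s : ℝ} (hs : 0 < s) (hs2 : s < 2) :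
    IntegrableOn (fun x : ℝ => x ^ (s - 1) * (1 + x ^ 2)⁻¹) (Set.Ioi 0) ∧
      ∫ x in Set.Ioi (0 : ℝ), x ^ (s - 1) * (1 + x ^ 2)⁻¹ =
        Real.pi / (2 * Real.sin (Real.pi * s / 2)) := by
  obtain ⟨h1, h2⟩ := integral_rpow_div_one_add (a := s / 2) (by linarith) (by linarith)
  have heq : ∀ x ∈ Set.Ioi (0 : ℝ), x ^ ((2 : ℝ) - 1) * ((x ^ (2 : ℝ)) ^ (s / 2 - 1) *
      (1 + x ^ (2 : ℝ))⁻¹) = x ^ (s - 1) * (1 + x ^ 2)⁻¹ := by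
    intro x hx
    have hx' : 0 < x := hx
    rw [← Real.rpow_mul hx'.le, ← mul_assoc, ← Real.rpow_add hx', Real.rpow_two]
    congr 2; ring
  refine ⟨?_, ?_⟩
  · have := (integrableOn_Ioi_comp_rpow_iff' (fun v : ℝ => v ^ (s / 2 - 1) * (1 + v)⁻¹)
      two_ne_zero).2 h1
    exact this.congr_fun (fun x hx => by simpa only [smul_eq_mul] using heq x hx)
      measurableSet_Ioi
  · have := integral_comp_rpow_Ioi_of_pos (g := fun v : ℝ => v ^ (s / 2 - 1) * (1 + v)⁻¹)
      (p := 2) two_pos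
    simp only [smul_eq_mul, mul_assoc] at this
    rw [integral_const_mul, setIntegral_congr_fun measurableSet_Ioi heq, h2] at this
    rw [show Real.pi * s / 2 = Real.pi * (s / 2) by ring]
    rw [eq_comm, mul_comm (2 : ℝ), ← div_div, ← this]; ring

lemma tendsto_exp_neg_mul_bounded {s : ℝ} (hs : 0 < s) {b : ℝ → ℝ} {M : ℝ} (hb : ∀ t, |b t| ≤ M) :
    Tendsto (fun t => Real.exp (-(s * t)) * b t) atTop (nhds 0) := by
  have h1 : Tendsto (fun t => Real.exp (-(s * t))) atTop (nhds 0) :=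
    Real.tendsto_exp_neg_atTop_nhds_zero.comp (tendsto_id.const_mul_atTop hs)
  exact h1.zero_mul_isBoundedUnder_le (isBoundedUnder_of ⟨M, hb⟩)

lemma integral_one_sub_cos_mul_exp {s : ℝ} (hs : 0 < s) :
    IntegrableOn (fun t => (1 - Real.cos t) * Real.exp (-(s * t))) (Set.Ioi 0) ∧
      ∫ t in Set.Ioi 0, (1 - Real.cos t) * Real.exp (-(s * t)) = s⁻¹ * (1 + s ^ 2)⁻¹ := by
  have hd : ∀ t ∈ Set.Ici (0 : ℝ), HasDerivAt
      (fun t => Real.exp (-(s * t)) * ((s * Real.cos t - Real.sin t) / (1 + s ^ 2) - 1 / s))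
      ((1 - Real.cos t) * Real.exp (-(s * t))) t := by
    intro t _
    have h1 : HasDerivAt (fun t => Real.exp (-(s * t))) (Real.exp (-(s * t)) * (-(s * 1))) t :=
      ((hasDerivAt_id t).const_mul s).neg.exp
    have h2 := ((((Real.hasDerivAt_cos t).const_mul s).sub (Real.hasDerivAt_sin t)).div_const
      (1 + s ^ 2)).sub_const (1 / s)
    refine (h1.mul h2).congr_deriv ?_
    simp only [Pi.sub_apply]
    field_simp
    ring
  have hn : ∀ t ∈ Set.Ioi (0 : ℝ), 0 ≤ (1 - Real.cos t) * Real.exp (-(s * t)) := fun t _ =>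
    mul_nonneg (by linarith [Real.cos_le_one t]) (Real.exp_pos _).le
  have hl : Tendsto
      (fun t => Real.exp (-(s * t)) * ((s * Real.cos t - Real.sin t) / (1 + s ^ 2) - 1 / s))
      atTop (nhds 0) := by
    refine tendsto_exp_neg_mul_bounded hs (M := (s + 1) / (1 + s ^ 2) + 1 / s) fun t => ?_
    refine (abs_sub _ _).trans ?_
    rw [abs_div, abs_of_pos (show 0 < 1 + s ^ 2 by positivity), abs_of_pos (one_div_pos.2 hs)]
    gcongr
    refine (abs_sub _ _).trans ?_
    rw [abs_mul, abs_of_pos hs]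
    nlinarith [Real.abs_cos_le_one t, Real.abs_sin_le_one t]
  refine ⟨integrableOn_Ioi_deriv_of_nonneg' hd hn hl, ?_⟩
  rw [integral_Ioi_of_hasDerivAt_of_nonneg' hd hn hl]
  simp
  field_simp
  ring

lemma integral_sub_sin_mul_exp {s : ℝ} (hs : 0 < s) :
    IntegrableOn (fun t => (t - Real.sin t) * Real.exp (-(s * t))) (Set.Ioi 0) ∧
      ∫ t in Set.Ioi 0, (t - Real.sin t) * Real.exp (-(s * t)) = (s ^ 2)⁻¹ * (1 + s ^ 2)⁻¹ := by
  have hd : ∀ t ∈ Set.Ici (0 : ℝ), HasDerivAt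
      (fun t => Real.exp (-(s * t)) * ((s * Real.sin t + Real.cos t) / (1 + s ^ 2) - 1 / s ^ 2)
        - Real.exp (-(s * t)) * t / s)
      ((t - Real.sin t) * Real.exp (-(s * t))) t := by
    intro t _
    have h1 : HasDerivAt (fun t => Real.exp (-(s * t))) (Real.exp (-(s * t)) * (-(s * 1))) t :=
      ((hasDerivAt_id t).const_mul s).neg.exp
    have h2 := ((((Real.hasDerivAt_sin t).const_mul s).add (Real.hasDerivAt_cos t)).div_const
      (1 + s ^ 2)).sub_const (1 / s ^ 2)
    refine ((h1.mul h2).sub ((h1.mul (hasDerivAt_id t)).div_const s)).congr_deriv ?_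
    simp only [id, Pi.add_apply]
    field_simp
    ring
  have hn : ∀ t ∈ Set.Ioi (0 : ℝ), 0 ≤ (t - Real.sin t) * Real.exp (-(s * t)) := fun t ht =>
    mul_nonneg (by linarith [Real.sin_le (le_of_lt ht)]) (Real.exp_pos _).le
  have hl : Tendsto
      (fun t => Real.exp (-(s * t)) * ((s * Real.sin t + Real.cos t) / (1 + s ^ 2) - 1 / s ^ 2)
        - Real.exp (-(s * t)) * t / s) atTop (nhds 0) := by
    rw [show (0 : ℝ) = 0 - 0 / s by simp]
    refine Tendsto.sub ?_ (Tendsto.div_const ?_ s)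
    · refine tendsto_exp_neg_mul_bounded hs (M := (s + 1) / (1 + s ^ 2) + 1 / s ^ 2) fun t => ?_
      refine (abs_sub _ _).trans ?_
      rw [abs_div, abs_of_pos (show 0 < 1 + s ^ 2 by positivity),
        abs_of_pos (show 0 < 1 / s ^ 2 by positivity)]
      gcongr
      refine (abs_add_le _ _).trans ?_
      rw [abs_mul, abs_of_pos hs]
      nlinarith [Real.abs_cos_le_one t, Real.abs_sin_le_one t]
    · have := tendsto_rpow_mul_exp_neg_mul_atTop_nhds_zero 1 s hs
      refine this.congr fun t => ?_
      rw [Real.rpow_one, mul_comm, neg_mul]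
  refine ⟨integrableOn_Ioi_deriv_of_nonneg' hd hn hl, ?_⟩
  rw [integral_Ioi_of_hasDerivAt_of_nonneg' hd hn hl]
  simp
  field_simp
  ring

lemma integral_sub_sin_div_cube :
    IntegrableOn (fun t : ℝ => (t - Real.sin t) / t ^ 3) (Set.Ioi 0) ∧
      ∫ t in Set.Ioi (0 : ℝ), (t - Real.sin t) / t ^ 3 = Real.pi / 4 := by
  have heq : ∀ s ∈ Set.Ioi (0 : ℝ),
      s ^ ((3 : ℝ) - 1) * ((s ^ 2)⁻¹ * (1 + s ^ 2)⁻¹) = (1 + s ^ 2)⁻¹ := by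
    intro s hs
    have hs' : 0 < s := hs
    rw [show (3 : ℝ) - 1 = 2 by norm_num, Real.rpow_two]
    field_simp
  have heq2 : ∀ t ∈ Set.Ioi (0 : ℝ), (t - Real.sin t) * t ^ (-(3 : ℝ)) =
      (t - Real.sin t) / t ^ 3 := by
    intro t ht
    rw [Real.rpow_neg (le_of_lt ht), div_eq_mul_inv]
    norm_cast
  obtain ⟨h1, h2⟩ := integral_mul_rpow_neg_eq_laplace (p := fun t => t - Real.sin t)
    (L := fun s => (s ^ 2)⁻¹ * (1 + s ^ 2)⁻¹) (r := 3) (by norm_num) (by fun_prop)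
    (fun t ht => by linarith [Real.sin_le ht.le]) (fun s hs => (integral_sub_sin_mul_exp hs).1)
    (fun s hs => (integral_sub_sin_mul_exp hs).2)
    (integrable_inv_one_add_sq.integrableOn.congr_fun (fun s hs => (heq s hs).symm)
      measurableSet_Ioi)
  refine ⟨h1.congr_fun heq2 measurableSet_Ioi, ?_⟩
  rw [← setIntegral_congr_fun measurableSet_Ioi heq2, h2,
    setIntegral_congr_fun measurableSet_Ioi heq, integral_Ioi_inv_one_add_sq, Real.arctan_zero,
    show (3 : ℝ) = ((2 : ℕ) : ℝ) + 1 by norm_num, Real.Gamma_nat_eq_factorial]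
  norm_num
  ring

lemma integral_one_sub_cos_mul_rpow {s : ℝ} (hs : 0 < s) (hs2 : s < 2) :
    IntegrableOn (fun t : ℝ => (1 - Real.cos t) * t ^ (-(1 + s))) (Set.Ioi 0) ∧
      ∫ t in Set.Ioi (0 : ℝ), (1 - Real.cos t) * t ^ (-(1 + s)) =
        Real.pi / (2 * Real.Gamma (1 + s) * Real.sin (Real.pi * s / 2)) := by
  have heq : ∀ x ∈ Set.Ioi (0 : ℝ),
      x ^ (s - 1) * (1 + x ^ 2)⁻¹ = x ^ (1 + s - 1) * (x⁻¹ * (1 + x ^ 2)⁻¹) := by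
    intro x hx
    rw [Real.rpow_sub_one (ne_of_gt hx), add_sub_cancel_left]
    ring
  obtain ⟨h3, h4⟩ := integral_rpow_div_one_add_sq hs hs2
  obtain ⟨h1, h2⟩ := integral_mul_rpow_neg_eq_laplace (p := fun t => 1 - Real.cos t)
    (L := fun s => s⁻¹ * (1 + s ^ 2)⁻¹) (r := 1 + s) (by linarith) (by fun_prop)
    (fun t _ => by linarith [Real.cos_le_one t]) (fun s hs => (integral_one_sub_cos_mul_exp hs).1)
    (fun s hs => (integral_one_sub_cos_mul_exp hs).2) (h3.congr_fun heq measurableSet_Ioi)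
  refine ⟨h1, ?_⟩
  rw [h2, ← setIntegral_congr_fun measurableSet_Ioi heq, h4]
  ring

/-- The antiderivative `z |z| / 2` of the absolute value. -/
noncomputable def absPrim (z : ℝ) : ℝ := z * |z| / 2

lemma continuous_absPrim : Continuous absPrim := by unfold absPrim; fun_prop

lemma absPrim_neg (z : ℝ) : absPrim (-z) = -absPrim z := by
  rw [absPrim, absPrim, abs_neg]; ring

lemma hasDerivAt_absPrim (z : ℝ) : HasDerivAt absPrim |z| z := by
  rcases lt_trichotomy z 0 with h | rfl | h
  · have h1 : HasDerivAt (fun x : ℝ => -(x * x) / 2) |z| z := by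
      refine (((hasDerivAt_id z).mul (hasDerivAt_id z)).neg.div_const 2).congr_deriv ?_
      rw [abs_of_neg h]; simp
    refine h1.congr_of_eventuallyEq ?_
    filter_upwards [eventually_lt_nhds h] with x hx
    rw [absPrim, abs_of_neg hx]; ring
  · rw [abs_zero, hasDerivAt_iff_tendsto_slope_zero]
    have : Tendsto (fun t : ℝ => |t| / 2) (nhds 0) (nhds 0) := by
      have : Continuous fun t : ℝ => |t| / 2 := by fun_prop
      simpa using this.tendsto 0
    refine (this.mono_left nhdsWithin_le_nhds).congr' ?_
    filter_upwards [self_mem_nhdsWithin] with t ht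
    have : t ≠ 0 := ht
    simp only [absPrim, smul_eq_mul, zero_add, zero_mul, zero_div, sub_zero]
    field_simp
  · have h1 : HasDerivAt (fun x : ℝ => x * x / 2) |z| z := by
      refine (((hasDerivAt_id z).mul (hasDerivAt_id z)).div_const 2).congr_deriv ?_
      rw [abs_of_pos h]; simp
    refine h1.congr_of_eventuallyEq ?_
    filter_upwards [eventually_gt_nhds h] with x hx
    rw [absPrim, abs_of_pos hx]

lemma integral_sub_sin_mul_div_cube (z : ℝ) :
    IntegrableOn (fun t : ℝ => (t * z - Real.sin (t * z)) / t ^ 3) (Set.Ioi 0) ∧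
      ∫ t in Set.Ioi (0 : ℝ), (t * z - Real.sin (t * z)) / t ^ 3 = Real.pi / 2 * absPrim z := by
  have hpos : ∀ z : ℝ, 0 < z →
      IntegrableOn (fun t : ℝ => (t * z - Real.sin (t * z)) / t ^ 3) (Set.Ioi 0) ∧
      ∫ t in Set.Ioi (0 : ℝ), (t * z - Real.sin (t * z)) / t ^ 3 = Real.pi / 2 * absPrim z := by
    intro z hz
    obtain ⟨h1, h2⟩ := integral_sub_sin_div_cube
    have heq : ∀ t : ℝ, (t * z - Real.sin (t * z)) / t ^ 3 =
        z ^ 3 * ((fun t => (t - Real.sin t) / t ^ 3) (t * z)) := by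
      intro t
      rcases eq_or_ne t 0 with rfl | ht
      · simp
      · field_simp
    simp only [heq]
    refine ⟨?_, ?_⟩
    · refine Integrable.const_mul ?_ _
      have := (integrableOn_Ioi_comp_mul_right_iff (fun t : ℝ => (t - Real.sin t) / t ^ 3) 0 hz).2
      exact this (by simpa using h1)
    · rw [integral_const_mul,
        integral_comp_mul_right_Ioi (fun t : ℝ => (t - Real.sin t) / t ^ 3) 0 hz, zero_mul, h2,
        absPrim, abs_of_pos hz, smul_eq_mul]
      field_simp
      ring
  rcases lt_trichotomy z 0 with h | rfl | h
  · obtain ⟨h1, h2⟩ := hpos (-z) (by linarith)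
    have heq : ∀ t : ℝ, (t * z - Real.sin (t * z)) / t ^ 3 =
        -((t * -z - Real.sin (t * -z)) / t ^ 3) := by
      intro t
      rw [mul_neg, Real.sin_neg]; ring
    simp only [heq]
    refine ⟨h1.neg, ?_⟩
    rw [integral_neg, h2, absPrim_neg]; ring
  · simp [absPrim]
  · exact hpos z h

/-- The average of `(sign (y - u) + sign (y + u)) / 2` over `u = 1 + w (a + b)`, where `a`, `b` are
independent and uniform on `[0, 1]`. -/
noncomputable def smoothSign (w y : ℝ) : ℝ :=
  (absPrim (y + 1 + 2 * w) - 2 * absPrim (y + 1 + w) + absPrim (y + 1) +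
    (absPrim (y - 1 - 2 * w) - 2 * absPrim (y - 1 - w) + absPrim (y - 1))) / (2 * w ^ 2)

/-- The average of `cos (t u)` over `u = 1 + w (a + b)`, where `a`, `b` are independent and uniform
on `[0, 1]`. -/
noncomputable def smoothCos (w t : ℝ) : ℝ :=
  2 * Real.cos (t * (1 + w)) * (1 - Real.cos (t * w)) / (t * w) ^ 2

lemma continuous_smoothSign (w : ℝ) : Continuous (smoothSign w) := by
  unfold smoothSign
  have := continuous_absPrim
  fun_prop

lemma smoothSign_zero (w : ℝ) : smoothSign w 0 = 0 := by
  simp only [smoothSign, zero_add, zero_sub]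
  rw [show -1 - 2 * w = -(1 + 2 * w) by ring, show -1 - w = -(1 + w) by ring]
  simp only [absPrim_neg]
  ring

@[fun_prop]
lemma measurable_smoothCos (w : ℝ) : Measurable (smoothCos w) := by
  unfold smoothCos; fun_prop

lemma two_mul_cos_mul_one_sub_cos (t w : ℝ) :
    2 * Real.cos (t * (1 + w)) * (1 - Real.cos (t * w)) =
      2 * Real.cos (t * (1 + w)) - Real.cos t - Real.cos (t * (1 + 2 * w)) := by
  have h1 := Real.cos_add (t * (1 + w)) (t * w)
  have h2 := Real.cos_sub (t * (1 + w)) (t * w)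
  rw [show t * (1 + w) + t * w = t * (1 + 2 * w) by ring] at h1
  rw [show t * (1 + w) - t * w = t by ring] at h2
  linarith

lemma sin_mul_cos_half (p q : ℝ) :
    Real.sin p * Real.cos q = (Real.sin (p + q) + Real.sin (p - q)) / 2 := by
  rw [Real.sin_add, Real.sin_sub]; ring

lemma integral_sin_mul_smoothCos {w : ℝ} (hw : w ≠ 0) (y : ℝ) :
    IntegrableOn (fun t => Real.sin (t * y) * (smoothCos w t / t)) (Set.Ioi 0) ∧
      ∫ t in Set.Ioi 0, Real.sin (t * y) * (smoothCos w t / t) =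
        Real.pi / 2 * smoothSign w y := by
  set θ : ℝ → ℝ → ℝ := fun z t => (t * z - Real.sin (t * z)) / t ^ 3 with hθ
  have heq : Set.EqOn (fun t => (θ (y + 1 + 2 * w) t - 2 * θ (y + 1 + w) t + θ (y + 1) t +
      (θ (y - 1 - 2 * w) t - 2 * θ (y - 1 - w) t + θ (y - 1) t)) / (2 * w ^ 2))
      (fun t => Real.sin (t * y) * (smoothCos w t / t)) (Set.Ioi 0) := by
    intro t ht
    have ht' : t ≠ 0 := ne_of_gt ht
    have e1 := sin_mul_cos_half (t * y) (t * (1 + w))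
    have e2 := sin_mul_cos_half (t * y) t
    have e3 := sin_mul_cos_half (t * y) (t * (1 + 2 * w))
    have e4 : Real.sin (t * y) * (smoothCos w t / t) =
        (2 * (Real.sin (t * y) * Real.cos (t * (1 + w))) - Real.sin (t * y) * Real.cos t -
          Real.sin (t * y) * Real.cos (t * (1 + 2 * w))) / (t ^ 3 * w ^ 2) := by
      rw [smoothCos, two_mul_cos_mul_one_sub_cos]
      field_simp
    simp only [e4, hθ]
    rw [e1, e2, e3, show t * y + t * (1 + w) = t * (y + 1 + w) by ring,
      show t * y - t * (1 + w) = t * (y - 1 - w) by ring,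
      show t * y + t = t * (y + 1) by ring, show t * y - t = t * (y - 1) by ring,
      show t * y + t * (1 + 2 * w) = t * (y + 1 + 2 * w) by ring,
      show t * y - t * (1 + 2 * w) = t * (y - 1 - 2 * w) by ring]
    field_simp
    ring
  have hI : ∀ z, IntegrableOn (fun t => θ z t) (Set.Ioi 0) :=
    fun z => (integral_sub_sin_mul_div_cube z).1
  have hV : ∀ z, ∫ t in Set.Ioi 0, θ z t = Real.pi / 2 * absPrim z :=
    fun z => (integral_sub_sin_mul_div_cube z).2
  have hI2 : ∀ a b, IntegrableOn (fun t => θ a t - 2 * θ b t) (Set.Ioi 0) :=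
    fun a b => (hI a).sub ((hI b).const_mul 2)
  have hI3 : ∀ a b c, IntegrableOn (fun t => θ a t - 2 * θ b t + θ c t) (Set.Ioi 0) :=
    fun a b c => (hI2 a b).add (hI c)
  have e : ∀ a b c : ℝ,
      ∫ t in Set.Ioi 0, (θ a t - 2 * θ b t + θ c t) =
        Real.pi / 2 * (absPrim a - 2 * absPrim b + absPrim c) := by
    intro a b c
    rw [integral_add (hI2 a b) (hI c), integral_sub (hI a) ((hI b).const_mul 2),
      integral_const_mul, hV, hV, hV]
    ring
  refine ⟨IntegrableOn.congr_fun (((hI3 _ _ _).add (hI3 _ _ _)).div_const _) heq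
    measurableSet_Ioi, ?_⟩
  rw [← setIntegral_congr_fun measurableSet_Ioi heq, integral_div]
  rw [integral_add (hI3 _ _ _) (hI3 _ _ _), e, e, smoothSign]
  ring

lemma abs_smoothCos_le_one (w t : ℝ) : |smoothCos w t| ≤ 1 := by
  have h0 : 0 ≤ 1 - Real.cos (t * w) := by linarith [Real.cos_le_one (t * w)]
  rw [smoothCos, abs_div, abs_mul, abs_mul, abs_of_nonneg h0, abs_of_nonneg (sq_nonneg (t * w)),
    abs_two]
  refine div_le_one_of_le₀ ?_ (sq_nonneg _)
  have := Real.one_sub_sq_div_two_le_cos (x := t * w)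
  nlinarith [Real.abs_cos_le_one (t * (1 + w)), abs_nonneg (Real.cos (t * (1 + w)))]

lemma abs_smoothCos_le (w t : ℝ) : |smoothCos w t| ≤ 4 / (t * w) ^ 2 := by
  have h0 : 0 ≤ 1 - Real.cos (t * w) := by linarith [Real.cos_le_one (t * w)]
  rw [smoothCos, abs_div, abs_mul, abs_mul, abs_of_nonneg h0, abs_of_nonneg (sq_nonneg (t * w)),
    abs_two]
  gcongr
  nlinarith [Real.abs_cos_le_one (t * (1 + w)), abs_nonneg (Real.cos (t * (1 + w))),
    Real.neg_one_le_cos (t * w)]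

lemma one_sub_cos_le_abs (θ : ℝ) : 1 - Real.cos θ ≤ |θ| := by
  rcases le_total |θ| 2 with h | h
  · have := Real.one_sub_sq_div_two_le_cos (x := θ)
    rw [← sq_abs] at this
    nlinarith [abs_nonneg θ]
  · linarith [Real.neg_one_le_cos θ]

lemma abs_smoothCos_sub_one_le {w : ℝ} (hw : w ≠ 0) {t : ℝ} (ht : 0 < t) :
    |smoothCos w t - 1| ≤ (2 * |w| + |1 + w|) * t := by
  rcases le_total |t * w| 1 with h | h
  · set x := t * w with hx
    have hx0 : x ≠ 0 := mul_ne_zero ht.ne' hw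
    have hxp : 0 < |x| := abs_pos.2 hx0
    have hq : |2 * (1 - Real.cos x) / x ^ 2 - 1| ≤ 2 * |x| := by
      have hb := Real.cos_bound h
      have : 2 * (1 - Real.cos x) / x ^ 2 - 1 = -2 * (Real.cos x - (1 - x ^ 2 / 2)) / x ^ 2 := by
        field_simp; ring
      rw [this, abs_div, abs_mul, abs_of_nonneg (sq_nonneg x), div_le_iff₀ (by positivity),
        abs_neg, abs_two]
      have h3 : |x| ^ 4 ≤ |x| ^ 3 := pow_le_pow_of_le_one hxp.le h (by norm_num)
      have h4 : |x| ^ 3 = |x| * x ^ 2 := by rw [← sq_abs x]; ring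
      nlinarith [pow_pos hxp 3]
    have hc := one_sub_cos_le_abs (t * (1 + w))
    have hc1 := Real.cos_le_one (t * (1 + w))
    have hs : smoothCos w t - 1 = Real.cos (t * (1 + w)) * (2 * (1 - Real.cos x) / x ^ 2 - 1) -
        (1 - Real.cos (t * (1 + w))) := by
      rw [smoothCos]; ring
    rw [hs]
    refine (abs_sub _ _).trans ?_
    rw [abs_mul, abs_of_nonneg (show 0 ≤ 1 - Real.cos (t * (1 + w)) by linarith)]
    have h5 : |x| = |w| * t := by rw [hx, abs_mul, abs_of_pos ht, mul_comm]
    have h6 : |t * (1 + w)| = |1 + w| * t := by rw [abs_mul, abs_of_pos ht, mul_comm]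
    have h7 := mul_le_mul (Real.abs_cos_le_one (t * (1 + w))) hq (abs_nonneg _) zero_le_one
    rw [h6] at hc
    rw [h5] at h7
    linarith
  · have h1 := abs_smoothCos_le_one w t
    have h2 : |smoothCos w t - 1| ≤ 2 := by
      refine (abs_sub _ _).trans ?_
      rw [abs_one]; linarith
    rw [abs_mul, abs_of_pos ht] at h
    nlinarith [abs_nonneg (1 + w)]

lemma integrableOn_smoothCos_sub_div {w : ℝ} (hw : w ≠ 0) {R : ℝ} (hR : 0 < R) :
    IntegrableOn (fun t => (smoothCos w t - smoothCos w (R * t)) / t) (Set.Ioi 0) := by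
  have hm : Measurable fun t => (smoothCos w t - smoothCos w (R * t)) / t := by fun_prop
  set B := 2 * |w| + |1 + w| with hB
  rw [← Set.Ioc_union_Ioi_eq_Ioi zero_le_one]
  refine IntegrableOn.union ?_ ?_
  · refine Integrable.mono' (g := fun _ => B * (1 + R)) ?_ hm.aestronglyMeasurable ?_
    · exact integrableOn_const (by simp)
    filter_upwards [ae_restrict_mem measurableSet_Ioc] with t ht
    have h1 := abs_smoothCos_sub_one_le hw ht.1
    have h2 := abs_smoothCos_sub_one_le hw (mul_pos hR ht.1)
    rw [Real.norm_eq_abs, abs_div, abs_of_pos ht.1, div_le_iff₀ ht.1]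
    rw [abs_le] at h1 h2 ⊢
    constructor <;> linarith [h1.1, h1.2, h2.1, h2.2]
  · have h1 : IntegrableOn (fun t : ℝ => t ^ (-3 : ℝ)) (Set.Ioi 1) :=
      integrableOn_Ioi_rpow_of_lt (by norm_num) one_pos
    refine Integrable.mono' (h1.const_mul (4 / w ^ 2 * (1 + 1 / R ^ 2)))
      hm.aestronglyMeasurable ?_
    filter_upwards [ae_restrict_mem measurableSet_Ioi] with t ht
    have ht0 : 0 < t := zero_lt_one.trans ht
    have h1 := abs_smoothCos_le w t
    have h2 := abs_smoothCos_le w (R * t)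
    rw [Real.norm_eq_abs, abs_div, abs_of_pos ht0, Real.rpow_neg ht0.le, div_le_iff₀ ht0]
    refine (abs_sub _ _).trans ((add_le_add h1 h2).trans (le_of_eq ?_))
    rw [show (3 : ℝ) = ((3 : ℕ) : ℝ) by norm_num, Real.rpow_natCast]
    field_simp

lemma charFun'_im (μ : Measure ℝ) [IsProbabilityMeasure μ] (t : ℝ) :
    (charFun' μ t).im = ∫ x, Real.sin (t * x) ∂μ := by
  have hint : Integrable (fun x : ℝ => Complex.exp (Complex.I * t * x)) μ := by
    refine Integrable.of_bound (by fun_prop) 1 (Eventually.of_forall fun x => ?_)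
    rw [show Complex.I * t * x = ((t * x : ℝ) : ℂ) * Complex.I by push_cast; ring,
      Complex.norm_exp_ofReal_mul_I]
  have h := integral_im hint
  simp only [RCLike.im_to_complex] at h
  rw [charFun', ← h]
  congr 1
  ext x
  rw [show Complex.I * t * x = ((t * x : ℝ) : ℂ) * Complex.I by push_cast; ring,
    Complex.exp_ofReal_mul_I_im]

lemma continuous_integral_sin (μ : Measure ℝ) [IsProbabilityMeasure μ] :
    Continuous fun t : ℝ => ∫ x, Real.sin (t * x) ∂μ :=
  continuous_of_dominated (bound := fun _ => 1) (fun t => by fun_prop)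
    (fun t => Eventually.of_forall fun x => Real.abs_sin_le_one _) (integrable_const _)
    (Eventually.of_forall fun _ => by fun_prop)

lemma abs_integral_sin_le (μ : Measure ℝ) [IsProbabilityMeasure μ] (t : ℝ) :
    |∫ x, Real.sin (t * x) ∂μ| ≤ 1 := by
  have := norm_integral_le_of_norm_le_const (μ := μ) (C := 1) (f := fun x => Real.sin (t * x))
    (Eventually.of_forall fun x => Real.abs_sin_le_one _)
  simpa using this

lemma measurable_realSign : Measurable Real.sign := by
  unfold Real.sign
  exact Measurable.ite measurableSet_Iio measurable_const
    (Measurable.ite measurableSet_Ioi measurable_const measurable_const)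

lemma abs_realSign_le_one (x : ℝ) : |Real.sign x| ≤ 1 := by
  rcases Real.sign_apply_eq x with h | h | h <;> rw [h] <;> norm_num

lemma integrable_realSign_comp {α : Type*} [MeasurableSpace α] (μ : Measure α) [IsFiniteMeasure μ]
    {f : α → ℝ} (hf : Measurable f) : Integrable (fun x => Real.sign (f x)) μ :=
  Integrable.of_bound (measurable_realSign.comp hf).aestronglyMeasurable 1
    (Eventually.of_forall fun _ => abs_realSign_le_one _)

lemma integral_sign_sub (μ : Measure ℝ) [IsProbabilityMeasure μ] (x : ℝ) :
    ∫ y, Real.sign (y - x) ∂μ = 1 - 2 * interDF μ x := by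
  have h : ∀ y, Real.sign (y - x) =
      1 - (Set.Iio x).indicator 1 y - (Set.Iic x).indicator (1 : ℝ → ℝ) y := by
    intro y
    rcases lt_trichotomy y x with h | h | h
    · rw [Real.sign_of_neg (by linarith), Set.indicator_of_mem (Set.mem_Iio.2 h),
        Set.indicator_of_mem (Set.mem_Iic.2 h.le)]; simp
    · simp [h]
    · rw [Real.sign_of_pos (by linarith), Set.indicator_of_notMem (by simpa using h.le),
        Set.indicator_of_notMem (by simpa using h)]; simp
  have i1 : Integrable ((Set.Iio x).indicator (1 : ℝ → ℝ)) μ :=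
    (integrable_const (1 : ℝ)).indicator measurableSet_Iio
  have i2 : Integrable ((Set.Iic x).indicator (1 : ℝ → ℝ)) μ :=
    (integrable_const (1 : ℝ)).indicator measurableSet_Iic
  simp only [h]
  have i0 : Integrable (fun _ : ℝ => (1 : ℝ)) μ := integrable_const _
  have i01 : Integrable (fun y => 1 - (Set.Iio x).indicator (1 : ℝ → ℝ) y) μ := i0.sub i1
  rw [integral_sub i01 i2, integral_sub i0 i1,
    integral_indicator_one measurableSet_Iio, integral_indicator_one measurableSet_Iic]
  simp only [interDF, Measure.real, integral_const, measure_univ, ENNReal.toReal_one, smul_eq_mul]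
  ring

lemma tailDiff_eq_integral_sign (μ : Measure ℝ) [IsProbabilityMeasure μ] (x : ℝ) :
    tailDiff μ x = ∫ y, (Real.sign (y + x) + Real.sign (y - x)) / 2 ∂μ := by
  have h := integral_sign_sub μ (-x)
  simp only [sub_neg_eq_add] at h
  rw [integral_div, integral_add (integrable_realSign_comp μ (by fun_prop))
    (integrable_realSign_comp μ (by fun_prop)), h, integral_sign_sub, tailDiff]
  ring

lemma integral_realSign (u v : ℝ) : ∫ x in u..v, Real.sign x = |v| - |u| := by
  refine integral_eq_of_hasDerivAt_off_countable (fun x => |x|) Real.sign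
    (Set.countable_singleton (0 : ℝ)) (by fun_prop) ?_ ?_
  · rintro x ⟨-, hx⟩
    rcases lt_or_gt_of_ne (show x ≠ 0 from hx) with h | h
    · rw [Real.sign_of_neg h]; exact hasDerivAt_abs_neg h
    · rw [Real.sign_of_pos h]; exact hasDerivAt_abs_pos h
  · rw [intervalIntegrable_iff, Set.uIoc]
    exact integrable_realSign_comp _ measurable_id

/-- The uniform distribution on the unit square. -/
noncomputable def unifSquare : Measure (ℝ × ℝ) :=
  (volume.restrict (Set.Ioc 0 1)).prod (volume.restrict (Set.Ioc 0 1))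

instance : IsProbabilityMeasure unifSquare := by
  have : IsProbabilityMeasure (volume.restrict (Set.Ioc (0 : ℝ) 1)) := ⟨by simp⟩
  unfold unifSquare
  infer_instance

lemma ae_mem_unifSquare :
    ∀ᵐ p ∂unifSquare, 0 ≤ p.1 + p.2 ∧ p.1 + p.2 ≤ 2 := by
  have : ∀ᵐ p ∂unifSquare, p ∈ Set.Ioc (0 : ℝ) 1 ×ˢ Set.Ioc (0 : ℝ) 1 := by
    rw [unifSquare, Measure.prod_restrict]
    exact ae_restrict_mem (measurableSet_Ioc.prod measurableSet_Ioc)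
  filter_upwards [this] with p hp
  exact ⟨by linarith [hp.1.1, hp.2.1], by linarith [hp.1.2, hp.2.2]⟩

lemma integral_unifSquare_sign {w : ℝ} (hw : w ≠ 0) (z : ℝ) :
    ∫ p, Real.sign (z + w * (p.1 + p.2)) ∂unifSquare =
      (absPrim (z + 2 * w) - 2 * absPrim (z + w) + absPrim z) / w ^ 2 := by
  rw [unifSquare, integral_prod]
  · have h1 : ∀ a : ℝ, ∫ b in Set.Ioc (0 : ℝ) 1, Real.sign (z + w * (a + b)) =
        w⁻¹ * (|(z + w) + w * a| - |z + w * a|) := by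
      intro a
      rw [← intervalIntegral.integral_of_le zero_le_one]
      have := intervalIntegral.integral_comp_add_mul (fun x => Real.sign x) hw (z + w * a)
        (a := 0) (b := 1)
      rw [integral_realSign, smul_eq_mul, mul_one, mul_zero, add_zero] at this
      rw [show z + w + w * a = z + w * a + w by ring, ← this]
      congr 1
      ext b
      ring_nf
    have h2 : ∀ c : ℝ, ∫ a in (0 : ℝ)..1, |c + w * a| = w⁻¹ * (absPrim (c + w) - absPrim c) := by
      intro c
      have := intervalIntegral.integral_comp_add_mul (fun x : ℝ => |x|) hw c (a := 0) (b := 1)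
      rw [intervalIntegral.integral_eq_sub_of_hasDerivAt (fun x _ => hasDerivAt_absPrim x)
        (Continuous.intervalIntegrable (by fun_prop) _ _)] at this
      simpa using this
    simp only [h1]
    rw [← intervalIntegral.integral_of_le zero_le_one, intervalIntegral.integral_const_mul,
      intervalIntegral.integral_sub (Continuous.intervalIntegrable (by fun_prop) _ _)
        (Continuous.intervalIntegrable (by fun_prop) _ _), h2, h2,
      show z + w + w = z + 2 * w by ring]
    field_simp
    ring
  · exact integrable_realSign_comp _ (by fun_prop)

lemma smoothSign_eq_integral {w : ℝ} (hw : w ≠ 0) (y : ℝ) :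
    smoothSign w y = ∫ p, (Real.sign (y + (1 + w * (p.1 + p.2))) +
      Real.sign (y - (1 + w * (p.1 + p.2)))) / 2 ∂unifSquare := by
  have h1 := integral_unifSquare_sign hw (y + 1)
  have h2 := integral_unifSquare_sign (neg_ne_zero.2 hw) (y - 1)
  rw [integral_div, integral_add (integrable_realSign_comp _ (by fun_prop))
    (integrable_realSign_comp _ (by fun_prop))]
  have e1 : ∀ p : ℝ × ℝ, y + (1 + w * (p.1 + p.2)) = y + 1 + w * (p.1 + p.2) := fun p => by ring
  have e2 : ∀ p : ℝ × ℝ, y - (1 + w * (p.1 + p.2)) = y - 1 + -w * (p.1 + p.2) := fun p => by ring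
  simp only [e1, e2]
  rw [h1, h2, smoothSign, neg_sq, show y - 1 + 2 * -w = y - 1 - 2 * w by ring,
    show y - 1 + -w = y - 1 - w by ring]
  field_simp

lemma abs_smoothSign_le_one {w : ℝ} (hw : w ≠ 0) (y : ℝ) : |smoothSign w y| ≤ 1 := by
  rw [smoothSign_eq_integral hw]
  have := norm_integral_le_of_norm_le_const (μ := unifSquare) (C := 1)
    (f := fun p => (Real.sign (y + (1 + w * (p.1 + p.2))) +
      Real.sign (y - (1 + w * (p.1 + p.2)))) / 2) (Eventually.of_forall fun p => ?_)
  · simpa using this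
  · rw [Real.norm_eq_abs, abs_div, abs_two, div_le_one two_pos]
    refine (abs_add_le _ _).trans ?_
    linarith [abs_realSign_le_one (y + (1 + w * (p.1 + p.2))),
      abs_realSign_le_one (y - (1 + w * (p.1 + p.2)))]

lemma integrable_smoothSign (μ : Measure ℝ) [IsProbabilityMeasure μ] {w : ℝ} (hw : w ≠ 0) (τ : ℝ) :
    Integrable (fun y => smoothSign w (τ * y)) μ := by
  have := continuous_smoothSign w
  exact Integrable.of_bound (by fun_prop) 1
    (Eventually.of_forall fun y => abs_smoothSign_le_one hw _)

lemma realSign_pos_mul {c : ℝ} (hc : 0 < c) (x : ℝ) : Real.sign (c * x) = Real.sign x := by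
  rcases lt_trichotomy x 0 with h | rfl | h
  · rw [Real.sign_of_neg h, Real.sign_of_neg (mul_neg_of_pos_of_neg hc h)]
  · rw [mul_zero]
  · rw [Real.sign_of_pos h, Real.sign_of_pos (mul_pos hc h)]

/-- The tail difference averaged around `τ⁻¹`. -/
lemma integral_tailDiff_unifSquare (μ : Measure ℝ) [IsProbabilityMeasure μ] {w τ : ℝ} (hw : w ≠ 0)
    (hτ : 0 < τ) :
    Integrable (fun p : ℝ × ℝ => tailDiff μ (τ⁻¹ * (1 + w * (p.1 + p.2)))) unifSquare ∧
    ∫ p, tailDiff μ (τ⁻¹ * (1 + w * (p.1 + p.2))) ∂unifSquare = ∫ y, smoothSign w (τ * y) ∂μ := by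
  set f : ℝ × ℝ → ℝ → ℝ := fun p y => (Real.sign (τ * y + (1 + w * (p.1 + p.2))) +
      Real.sign (τ * y - (1 + w * (p.1 + p.2)))) / 2 with hf
  have hK : ∀ p : ℝ × ℝ, tailDiff μ (τ⁻¹ * (1 + w * (p.1 + p.2))) = ∫ y, f p y ∂μ := by
    intro p
    rw [tailDiff_eq_integral_sign]
    congr 1
    ext y
    simp only [hf]
    rw [← realSign_pos_mul hτ, ← realSign_pos_mul hτ (y - _), mul_add, mul_sub,
      mul_inv_cancel_left₀ hτ.ne']
  have hint : Integrable (Function.uncurry f) (unifSquare.prod μ) := by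
    have h1 : Integrable (fun q : (ℝ × ℝ) × ℝ =>
        Real.sign (τ * q.2 + (1 + w * (q.1.1 + q.1.2)))) (unifSquare.prod μ) :=
      integrable_realSign_comp _ (by fun_prop)
    have h2 : Integrable (fun q : (ℝ × ℝ) × ℝ =>
        Real.sign (τ * q.2 - (1 + w * (q.1.1 + q.1.2)))) (unifSquare.prod μ) :=
      integrable_realSign_comp _ (by fun_prop)
    exact (h1.add h2).div_const 2
  simp only [hK]
  refine ⟨hint.integral_prod_left, ?_⟩
  rw [integral_integral_swap hint]
  congr 1
  ext y
  rw [smoothSign_eq_integral hw]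

lemma integral_smoothSign_sub (μ : Measure ℝ) [IsProbabilityMeasure μ] {w τ R : ℝ} (hw : w ≠ 0)
    (hR : 0 < R) :
    Real.pi / 2 * (∫ y, smoothSign w (τ * y) ∂μ - ∫ y, smoothSign w (τ * y / R) ∂μ) =
      ∫ t in Set.Ioi 0, (∫ y, Real.sin (t * τ * y) ∂μ) *
        ((smoothCos w t - smoothCos w (R * t)) / t) := by
  have hpt : ∀ y, ∫ t in Set.Ioi 0, Real.sin (t * τ * y) *
      ((smoothCos w t - smoothCos w (R * t)) / t) =
        Real.pi / 2 * (smoothSign w (τ * y) - smoothSign w (τ * y / R)) := by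
    intro y
    obtain ⟨h1, h2⟩ := integral_sin_mul_smoothCos hw (τ * y)
    obtain ⟨h3, h4⟩ := integral_sin_mul_smoothCos hw (τ * y / R)
    have heq : ∀ t : ℝ, Real.sin (t * (τ * y)) * (smoothCos w (R * t) / t) =
        R * (fun t => Real.sin (t * (τ * y / R)) * (smoothCos w t / t)) (R * t) := by
      intro t
      simp only []
      rw [show R * t * (τ * y / R) = t * (τ * y) by field_simp]
      rcases eq_or_ne t 0 with rfl | ht
      · simp
      · field_simp
    have h5 : IntegrableOn (fun t => Real.sin (t * (τ * y)) * (smoothCos w (R * t) / t))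
        (Set.Ioi 0) := by
      simp only [heq]
      refine Integrable.const_mul ?_ _
      exact (integrableOn_Ioi_comp_mul_left_iff _ 0 hR).2 (by simpa using h3)
    have h6 : ∫ t in Set.Ioi 0, Real.sin (t * (τ * y)) * (smoothCos w (R * t) / t) =
        Real.pi / 2 * smoothSign w (τ * y / R) := by
      have h7 := integral_comp_mul_left_Ioi
        (fun t => Real.sin (t * (τ * y / R)) * (smoothCos w t / t)) 0 hR
      rw [mul_zero, h4, smul_eq_mul] at h7
      simp only [heq]
      rw [integral_const_mul, h7, mul_inv_cancel_left₀ hR.ne']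
    rw [mul_sub, ← h2, ← h6, ← integral_sub h1 h5]
    congr 1
    ext t
    rw [mul_assoc t τ y]
    ring
  set f : ℝ → ℝ → ℝ := fun t y => Real.sin (t * τ * y) *
      ((smoothCos w t - smoothCos w (R * t)) / t) with hf
  have hint : Integrable (Function.uncurry f) ((volume.restrict (Set.Ioi 0)).prod μ) := by
    have h1 := (integrableOn_smoothCos_sub_div hw hR).mul_prod (integrable_const (μ := μ) (1 : ℝ))
    refine Integrable.mono h1 ?_ (Eventually.of_forall fun q => ?_)
    · refine Measurable.aestronglyMeasurable ?_
      simp only [hf, Function.uncurry_def]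
      fun_prop
    · simp only [hf, Function.uncurry_def, mul_one, norm_mul]
      exact mul_le_of_le_one_left (norm_nonneg _) (Real.abs_sin_le_one _)
  calc _ = ∫ y, (∫ t in Set.Ioi 0, f t y) ∂μ := by
        have h1 := integrable_smoothSign μ hw τ
        have h2 := integrable_smoothSign μ hw (τ / R)
        simp only [div_mul_eq_mul_div] at h2
        rw [← integral_sub h1 h2, ← integral_const_mul]
        congr 1
        ext y
        rw [hpt]
    _ = ∫ t in Set.Ioi 0, ∫ y, f t y ∂μ := (integral_integral_swap hint).symm
    _ = _ := by
        congr 1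
        ext t
        exact integral_mul_const _ _

/-- Inversion formula for the averaged tail difference. -/
lemma integral_smoothSign_eq (μ : Measure ℝ) [IsProbabilityMeasure μ] {w τ : ℝ} (hw : w ≠ 0)
    (hint : IntegrableOn (fun t => |∫ y, Real.sin (t * τ * y) ∂μ| *
      (min 1 (4 / (t * w) ^ 2) / t)) (Set.Ioi 0)) :
    Real.pi / 2 * ∫ y, smoothSign w (τ * y) ∂μ =
      ∫ t in Set.Ioi 0, (∫ y, Real.sin (t * τ * y) ∂μ) * (smoothCos w t / t) := by
  set v : ℝ → ℝ := fun t => ∫ y, Real.sin (t * τ * y) ∂μ with hv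
  have hvm : Measurable v := by
    have : Continuous v := (continuous_integral_sin μ).comp (continuous_mul_const τ)
    exact this.measurable
  have hbd : ∀ R ≥ 1, ∀ t > 0, ‖v t * (smoothCos w (R * t) / t)‖ ≤
      |v t| * (min 1 (4 / (t * w) ^ 2) / t) := by
    intro R hR t ht
    rw [norm_mul, norm_div, Real.norm_eq_abs, Real.norm_eq_abs, Real.norm_eq_abs, abs_of_pos ht]
    gcongr
    refine le_min (abs_smoothCos_le_one _ _) ((abs_smoothCos_le _ _).trans ?_)
    have : 0 < (t * w) ^ 2 := by positivity
    gcongr 4 / ?_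
    rw [show (R * t * w) ^ 2 = R ^ 2 * (t * w) ^ 2 by ring]
    exact le_mul_of_one_le_left this.le (one_le_pow₀ hR)
  have hI : ∀ R ≥ 1, IntegrableOn (fun t => v t * (smoothCos w (R * t) / t)) (Set.Ioi 0) := by
    intro R hR
    refine Integrable.mono' hint (by fun_prop) ?_
    filter_upwards [ae_restrict_mem measurableSet_Ioi] with t ht using hbd R hR t ht
  have hlim1 : Tendsto (fun R : ℝ => ∫ t in Set.Ioi 0, v t * (smoothCos w (R * t) / t)) atTop
      (nhds (∫ t in Set.Ioi (0 : ℝ), (0 : ℝ))) := by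
    refine tendsto_integral_filter_of_dominated_convergence _
      (Eventually.of_forall fun R => by fun_prop) ?_ hint ?_
    · filter_upwards [eventually_ge_atTop 1] with R hR
      filter_upwards [ae_restrict_mem measurableSet_Ioi] with t ht using hbd R hR t ht
    · filter_upwards [ae_restrict_mem measurableSet_Ioi] with t ht
      have ht' : 0 < t := ht
      have h1 : Tendsto (fun R : ℝ => smoothCos w (R * t)) atTop (nhds 0) := by
        refine squeeze_zero_norm (a := fun R => 4 / (R * t * w) ^ 2)
          (fun R => abs_smoothCos_le w _) ?_
        have h2 : Tendsto (fun R : ℝ => R ^ 2) atTop atTop := tendsto_pow_atTop two_ne_zero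
        have h3 := h2.const_div_atTop (4 / (t * w) ^ 2)
        refine h3.congr fun R => ?_
        rw [show (R * t * w) ^ 2 = (t * w) ^ 2 * R ^ 2 by ring, div_div]
      simpa using (h1.div_const t).const_mul (v t)
  have hlim2 : Tendsto (fun R : ℝ => ∫ y, smoothSign w (τ * y / R) ∂μ) atTop
      (nhds (∫ _, (0 : ℝ) ∂μ)) := by
    have hc := continuous_smoothSign w
    refine tendsto_integral_filter_of_dominated_convergence (fun _ => 1)
      (Eventually.of_forall fun R => by fun_prop)
      (Eventually.of_forall fun R => Eventually.of_forall fun y => abs_smoothSign_le_one hw _)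
      (integrable_const _) (Eventually.of_forall fun y => ?_)
    have h1 : Tendsto (fun R : ℝ => τ * y / R) atTop (nhds 0) := tendsto_id.const_div_atTop _
    have h2 := (hc.tendsto 0).comp h1
    rwa [smoothSign_zero] at h2
  have hA := (tendsto_const_nhds (x := ∫ y, smoothSign w (τ * y) ∂μ)).sub hlim2
  have hA := hA.const_mul (Real.pi / 2)
  have hB := (tendsto_const_nhds (x := ∫ t in Set.Ioi 0, v t * (smoothCos w t / t))).sub hlim1
  simp only [integral_zero, sub_zero] at hA hB
  refine tendsto_nhds_unique hA (hB.congr' ?_)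
  filter_upwards [eventually_ge_atTop 1] with R hR
  rw [integral_smoothSign_sub μ hw (by linarith)]
  have hI1 : IntegrableOn (fun t => v t * (smoothCos w t / t)) (Set.Ioi 0) := by
    simpa using hI 1 le_rfl
  rw [← integral_sub hI1 (hI R hR)]
  congr 1
  ext t
  simp only [hv]
  ring

lemma integrableOn_rpow_mul_min {w p : ℝ} (hw : w ≠ 0) (hp : 0 < p) (hp2 : p < 2) :
    IntegrableOn (fun t : ℝ => t ^ p * (min 1 (4 / (t * w) ^ 2) / t)) (Set.Ioi 0) := by
  rw [← Set.Ioc_union_Ioi_eq_Ioi zero_le_one]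
  refine IntegrableOn.union ?_ ?_
  · have h : IntegrableOn (fun t : ℝ => t ^ (p - 1)) (Set.Ioc 0 1) :=
      (intervalIntegrable_iff_integrableOn_Ioc_of_le zero_le_one).1
        (intervalIntegral.intervalIntegrable_rpow' (by linarith))
    refine Integrable.mono' h (Measurable.aestronglyMeasurable (by fun_prop)) ?_
    filter_upwards [ae_restrict_mem measurableSet_Ioc] with t ht
    have ht0 : 0 < t := ht.1
    have hm : 0 ≤ min 1 (4 / (t * w) ^ 2) := by positivity
    rw [Real.norm_of_nonneg (by positivity), Real.rpow_sub_one ht0.ne', div_eq_mul_one_div (t ^ p)]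
    gcongr
    exact min_le_left _ _
  · have h : IntegrableOn (fun t : ℝ => 4 / w ^ 2 * t ^ (p - 3)) (Set.Ioi 1) :=
      (integrableOn_Ioi_rpow_of_lt (by linarith) one_pos).const_mul _
    refine Integrable.mono' h (Measurable.aestronglyMeasurable (by fun_prop)) ?_
    filter_upwards [ae_restrict_mem measurableSet_Ioi] with t ht
    have ht0 : 0 < t := one_pos.trans ht
    have hm : 0 ≤ min 1 (4 / (t * w) ^ 2) := by positivity
    rw [Real.norm_of_nonneg (by positivity), Real.rpow_sub ht0]
    have h3 : t ^ (3 : ℝ) = t ^ 3 := by norm_cast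
    calc t ^ p * (min 1 (4 / (t * w) ^ 2) / t) ≤ t ^ p * (4 / (t * w) ^ 2 / t) := by
          gcongr
          exact min_le_right _ _
      _ = _ := by
          rw [h3]
          field_simp

/-- Abelian step: the averaged tail difference is asymptotically proportional to the
imaginary part of the characteristic function. -/
lemma tendsto_integral_smoothSign_div (μ : Measure ℝ) [IsProbabilityMeasure μ] {k δ w : ℝ}
    (hw : w ≠ 0) (hk : 0 < k) (hk2 : k < 2) (hδ : 0 < δ)
    (hne : ∀ t ∈ Set.Ioo 0 δ, ∫ x, Real.sin (t * x) ∂μ ≠ 0)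
    (hrv : ∀ l : ℝ, 0 < l →
      Tendsto (fun t : ℝ => (∫ x, Real.sin (l * t * x) ∂μ) / ∫ x, Real.sin (t * x) ∂μ)
        (nhdsWithin 0 (Set.Ioi 0)) (nhds (l ^ k))) :
    Tendsto (fun τ => (∫ y, smoothSign w (τ * y) ∂μ) / ∫ y, Real.sin (τ * y) ∂μ)
      (nhdsWithin 0 (Set.Ioi 0))
      (nhds (2 / Real.pi * ∫ t in Set.Ioi 0, t ^ k * (smoothCos w t / t))) := by
  set v : ℝ → ℝ := fun t => ∫ x, Real.sin (t * x) ∂μ with hv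
  have hvc : Continuous v := continuous_integral_sin μ
  obtain ⟨ε, hε, hε1, hε2⟩ : ∃ ε > 0, 0 < k - ε ∧ k + ε < 2 := by
    have : 0 < min k (2 - k) := lt_min hk (by linarith)
    exact ⟨min k (2 - k) / 2, by positivity, by linarith [min_le_left k (2 - k)],
      by linarith [min_le_right k (2 - k)]⟩
  obtain ⟨t₀, ht₀, ht₀δ, C, hC, hpot⟩ :=
    exists_potter_bound hvc (abs_integral_sin_le μ) hδ hne hk hε hrv
  set G : ℝ → ℝ := fun t => C * (t ^ (k - ε) * (min 1 (4 / (t * w) ^ 2) / t) +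
    t ^ (k + ε) * (min 1 (4 / (t * w) ^ 2) / t)) with hG
  have hGi : IntegrableOn G (Set.Ioi 0) :=
    ((integrableOn_rpow_mul_min hw hε1 (by linarith)).add
      (integrableOn_rpow_mul_min hw (by linarith) hε2)).const_mul C
  have hev : ∀ᶠ τ in nhdsWithin (0 : ℝ) (Set.Ioi 0), τ ∈ Set.Ioc 0 t₀ := Ioc_mem_nhdsGT ht₀
  have hvne : ∀ τ ∈ Set.Ioc 0 t₀, v τ ≠ 0 := fun τ hτ => hne τ ⟨hτ.1, hτ.2.trans_lt ht₀δ⟩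
  have hmin : ∀ t > 0, 0 ≤ min 1 (4 / (t * w) ^ 2) / t := fun t ht => by positivity
  have hpot' : ∀ τ ∈ Set.Ioc 0 t₀, ∀ t > 0,
      |v (t * τ)| * (min 1 (4 / (t * w) ^ 2) / t) ≤ |v τ| * G t := by
    intro τ hτ t ht
    calc _ ≤ C * |v τ| * (t ^ (k - ε) + t ^ (k + ε)) * (min 1 (4 / (t * w) ^ 2) / t) :=
          mul_le_mul_of_nonneg_right (hpot τ hτ t ht) (hmin t ht)
      _ = _ := by simp only [hG]; ring
  have hlim : Tendsto (fun τ => ∫ t in Set.Ioi 0, v (t * τ) / v τ * (smoothCos w t / t))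
      (nhdsWithin 0 (Set.Ioi 0)) (nhds (∫ t in Set.Ioi 0, t ^ k * (smoothCos w t / t))) := by
    have hvm := hvc.measurable
    refine tendsto_integral_filter_of_dominated_convergence G
      (Eventually.of_forall fun τ => Measurable.aestronglyMeasurable (by fun_prop)) ?_ hGi ?_
    · filter_upwards [hev] with τ hτ
      filter_upwards [ae_restrict_mem measurableSet_Ioi] with t ht
      have ht0 : 0 < t := ht
      have hvτ : 0 < |v τ| := abs_pos.2 (hvne τ hτ)
      have hs : |smoothCos w t| ≤ min 1 (4 / (t * w) ^ 2) :=
        le_min (abs_smoothCos_le_one _ _) (abs_smoothCos_le _ _)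
      rw [norm_mul, norm_div, norm_div, Real.norm_eq_abs, Real.norm_eq_abs, Real.norm_eq_abs,
        Real.norm_eq_abs, abs_of_pos ht0, div_mul_eq_mul_div, div_le_iff₀ hvτ, mul_comm (G t)]
      refine le_trans ?_ (hpot' τ hτ t ht)
      gcongr
    · filter_upwards [ae_restrict_mem measurableSet_Ioi] with t ht
      exact (hrv t ht).mul_const _
  refine (hlim.const_mul (2 / Real.pi)).congr' ?_
  filter_upwards [hev] with τ hτ
  have hint : IntegrableOn (fun t => |∫ y, Real.sin (t * τ * y) ∂μ| *
      (min 1 (4 / (t * w) ^ 2) / t)) (Set.Ioi 0) := by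
    have hvm := hvc.measurable
    refine Integrable.mono' (hGi.const_mul |v τ|)
      (Measurable.aestronglyMeasurable (f := fun t => |v (t * τ)| *
        (min 1 (4 / (t * w) ^ 2) / t)) (by fun_prop)) ?_
    filter_upwards [ae_restrict_mem measurableSet_Ioi] with t ht
    rw [Real.norm_of_nonneg (mul_nonneg (abs_nonneg _) (hmin t ht))]
    exact hpot' τ hτ t ht
  have h := integral_smoothSign_eq μ hw hint
  have h2 : ∫ y, smoothSign w (τ * y) ∂μ =
      2 / Real.pi * ∫ t in Set.Ioi 0, v (t * τ) * (smoothCos w t / t) := by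
    rw [← h]
    field_simp
  rw [h2, mul_div_assoc, ← integral_div]
  congr 2
  ext t
  ring

lemma integral_one_sub_cos_mul_mul_rpow {s a : ℝ} (hs : 0 < s) (hs2 : s < 2) (ha : 0 < a) :
    IntegrableOn (fun t : ℝ => (1 - Real.cos (t * a)) * t ^ (-(1 + s))) (Set.Ioi 0) ∧
    ∫ t in Set.Ioi (0 : ℝ), (1 - Real.cos (t * a)) * t ^ (-(1 + s)) =
      a ^ s * (Real.pi / (2 * Real.Gamma (1 + s) * Real.sin (Real.pi * s / 2))) := by
  obtain ⟨h1, h2⟩ := integral_one_sub_cos_mul_rpow hs hs2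
  set g : ℝ → ℝ := fun t => (1 - Real.cos t) * t ^ (-(1 + s)) with hg
  have heq : Set.EqOn (fun t : ℝ => (1 - Real.cos (t * a)) * t ^ (-(1 + s)))
      (fun t => a ^ (1 + s) * g (a * t)) (Set.Ioi 0) := by
    intro t ht
    have hpow : a ^ (1 + s) * (a ^ (-(1 + s))) = 1 := by
      rw [← Real.rpow_add ha, add_neg_cancel, Real.rpow_zero]
    simp only [hg]
    rw [Real.mul_rpow ha.le (le_of_lt ht), mul_comm a t]
    linear_combination (-(1 - Real.cos (t * a)) * t ^ (-(1 + s))) * hpow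
  constructor
  · rw [integrableOn_congr_fun heq measurableSet_Ioi]
    refine Integrable.const_mul ?_ _
    exact (integrableOn_Ioi_comp_mul_left_iff g 0 ha).2 (by simpa using h1)
  · rw [setIntegral_congr_fun measurableSet_Ioi heq, integral_const_mul,
      integral_comp_mul_left_Ioi g 0 ha, mul_zero, h2, smul_eq_mul, ← mul_assoc,
      Real.rpow_add ha, Real.rpow_one]
    field_simp

lemma integral_rpow_mul_smoothCos {k w : ℝ} (hk : 0 < k) (hk2 : k < 2) (hw : w ≠ 0)
    (hw2 : |w| < 1 / 2) :
    ∫ t in Set.Ioi (0 : ℝ), t ^ k * (smoothCos w t / t) =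
      Real.pi / (2 * Real.Gamma (1 + (2 - k)) * Real.sin (Real.pi * (2 - k) / 2)) *
        (((1 + 2 * w) ^ (2 - k) - 2 * (1 + w) ^ (2 - k) + 1) / w ^ 2) := by
  obtain ⟨hwl, hwr⟩ := abs_lt.1 hw2
  have hs : 0 < 2 - k := by linarith
  have hs2 : 2 - k < 2 := by linarith
  obtain ⟨i0, e0⟩ := integral_one_sub_cos_mul_mul_rpow hs hs2 one_pos
  obtain ⟨i1, e1⟩ := integral_one_sub_cos_mul_mul_rpow hs hs2 (show 0 < 1 + w by linarith)
  obtain ⟨i2, e2⟩ := integral_one_sub_cos_mul_mul_rpow hs hs2 (show 0 < 1 + 2 * w by linarith)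
  have heq : Set.EqOn (fun t : ℝ => t ^ k * (smoothCos w t / t))
      (fun t => (w ^ 2)⁻¹ * ((1 - Real.cos (t * 1)) * t ^ (-(1 + (2 - k))) +
        (1 - Real.cos (t * (1 + 2 * w))) * t ^ (-(1 + (2 - k))) -
        2 * ((1 - Real.cos (t * (1 + w))) * t ^ (-(1 + (2 - k)))))) (Set.Ioi 0) := by
    intro t ht
    have ht0 : 0 < t := ht
    have h3 : t ^ (3 : ℝ) = t ^ 3 := by norm_cast
    simp only [smoothCos]
    rw [two_mul_cos_mul_one_sub_cos, show -(1 + (2 - k)) = k - 3 by ring, Real.rpow_sub ht0, h3]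
    field_simp
    ring
  have i02 : IntegrableOn (fun t : ℝ => (1 - Real.cos (t * 1)) * t ^ (-(1 + (2 - k))) +
      (1 - Real.cos (t * (1 + 2 * w))) * t ^ (-(1 + (2 - k)))) (Set.Ioi 0) := i0.add i2
  rw [setIntegral_congr_fun measurableSet_Ioi heq, integral_const_mul,
    integral_sub i02 (i1.const_mul 2), integral_add i0 i2, integral_const_mul, e0, e1, e2,
    Real.one_rpow]
  ring

lemma tendsto_second_difference_rpow (s : ℝ) :
    Tendsto (fun w : ℝ => ((1 + 2 * w) ^ s - 2 * (1 + w) ^ s + 1) / w ^ 2)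
      (nhdsWithin 0 {0}ᶜ) (nhds (s * (s - 1))) := by
  have hd : ∀ (c p w : ℝ), 0 < 1 + c * w →
      HasDerivAt (fun w : ℝ => (1 + c * w) ^ p) (c * p * (1 + c * w) ^ (p - 1)) w := by
    intro c p w h
    have h1 : HasDerivAt (fun w : ℝ => 1 + c * w) c w := by
      simpa using ((hasDerivAt_id w).const_mul c).const_add 1
    exact h1.rpow_const (Or.inl h.ne')
  have hpos : ∀ c : ℝ, ∀ᶠ w in nhds (0 : ℝ), 0 < 1 + c * w := fun c =>
    (Continuous.tendsto' (by fun_prop) 0 1 (by simp)).eventually (lt_mem_nhds one_pos)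
  have hd1 : ∀ (p w : ℝ), 0 < 1 + w →
      HasDerivAt (fun w : ℝ => (1 + w) ^ p) (p * (1 + w) ^ (p - 1)) w := by
    intro p w h
    simpa using hd 1 p w (by simpa using h)
  have hslope : Tendsto (fun w : ℝ => s * (w⁻¹ * ((1 + 2 * w) ^ (s - 1) - (1 + w) ^ (s - 1))))
      (nhdsWithin 0 {0}ᶜ) (nhds (s * (s - 1))) := by
    have h := (hd 2 (s - 1) 0 (by simp)).sub (hd1 (s - 1) 0 (by simp))
    rw [hasDerivAt_iff_tendsto_slope_zero] at h
    refine Tendsto.const_mul s ?_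
    convert h using 2
    · simp
    · simp
      ring
  refine HasDerivAt.lhopital_zero_nhdsNE
    (f' := fun w => 2 * s * (1 + 2 * w) ^ (s - 1) - 2 * (s * (1 + w) ^ (s - 1)))
    (g' := fun w => 2 * w) ?_ ?_ ?_ ?_ ?_ ?_
  · refine nhdsWithin_le_nhds ?_
    filter_upwards [hpos 2, hpos 1] with w h2 h1
    exact ((hd 2 s w h2).sub ((hd1 s w (by simpa using h1)).const_mul 2)).add_const 1
  · exact Eventually.of_forall fun w => by simpa using hasDerivAt_pow 2 w
  · filter_upwards [self_mem_nhdsWithin] with w hw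
    simpa using hw
  · have h : ContinuousAt (fun w : ℝ => (1 + 2 * w) ^ s - 2 * (1 + w) ^ s + 1) 0 :=
      (((hd 2 s 0 (by simp)).continuousAt).sub
        (((hd1 s 0 (by simp)).continuousAt).const_mul 2)).add_const 1
    have h' := h.tendsto.mono_left (nhdsWithin_le_nhds (s := {0}ᶜ))
    convert h' using 2
    simp
    norm_num
  · have h : Tendsto (fun w : ℝ => w ^ 2) (nhds 0) (nhds 0) :=
      Continuous.tendsto' (by fun_prop) _ _ (by simp)
    exact h.mono_left nhdsWithin_le_nhds
  · refine hslope.congr' ?_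
    filter_upwards [self_mem_nhdsWithin] with w hw
    have hw0 : w ≠ 0 := hw
    field_simp

lemma gamma_sin_constant {k : ℝ} (hk : 0 < k) (hk2 : k < 2) (hk1 : k ≠ 1) :
    Real.Gamma (1 - k) * Real.sin (Real.pi * k / 2) ≠ 0 ∧
    2 / Real.pi * (Real.pi / (2 * Real.Gamma (1 + (2 - k)) * Real.sin (Real.pi * (2 - k) / 2)) *
      ((2 - k) * (2 - k - 1))) = (Real.Gamma (1 - k) * Real.sin (Real.pi * k / 2))⁻¹ := by
  have h1 : 1 - k ≠ 0 := sub_ne_zero.2 hk1.symm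
  have h2 : 2 - k ≠ 0 := by linarith
  have hG1 : Real.Gamma (2 - k) = (1 - k) * Real.Gamma (1 - k) := by
    rw [← Real.Gamma_add_one h1]
    ring_nf
  have hG2 : Real.Gamma (1 + (2 - k)) = (2 - k) * Real.Gamma (2 - k) := by
    rw [← Real.Gamma_add_one h2, add_comm]
  have hG3 : Real.Gamma (2 - k) ≠ 0 := (Real.Gamma_pos_of_pos (by linarith)).ne'
  have hG4 : Real.Gamma (1 - k) ≠ 0 := fun h => hG3 (by rw [hG1, h, mul_zero])
  have hsin : Real.sin (Real.pi * (2 - k) / 2) = Real.sin (Real.pi * k / 2) := by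
    rw [← Real.sin_pi_sub]
    ring_nf
  have hsin0 : Real.sin (Real.pi * k / 2) ≠ 0 := by
    refine (Real.sin_pos_of_pos_of_lt_pi (by positivity) ?_).ne'
    nlinarith [Real.pi_pos]
  refine ⟨mul_ne_zero hG4 hsin0, ?_⟩
  rw [hsin, hG2, hG1, show 2 - k - 1 = 1 - k by ring]
  field_simp

/-- A monotone tail difference lies between its averages to the right and to the left. -/
lemma tailDiff_mem_uIcc_of_monotoneOn (μ : Measure ℝ) [IsProbabilityMeasure μ] {x₀ w τ : ℝ}
    (hmono : MonotoneOn (tailDiff μ) (Set.Ioi x₀) ∨ AntitoneOn (tailDiff μ) (Set.Ioi x₀))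
    (hw : 0 < w) (hτ : 0 < τ) (hx : x₀ < τ⁻¹ * (1 - 2 * w)) :
    tailDiff μ τ⁻¹ ∈ Set.uIcc (∫ y, smoothSign w (τ * y) ∂μ) (∫ y, smoothSign (-w) (τ * y) ∂μ) := by
  obtain ⟨i1, e1⟩ := integral_tailDiff_unifSquare μ hw.ne' hτ
  obtain ⟨i2, e2⟩ := integral_tailDiff_unifSquare μ (neg_ne_zero.2 hw.ne') hτ
  have hτ' : 0 < τ⁻¹ := inv_pos.2 hτ
  have hc : ∫ _, tailDiff μ τ⁻¹ ∂unifSquare = tailDiff μ τ⁻¹ := by simp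
  have ic : Integrable (fun _ : ℝ × ℝ => tailDiff μ τ⁻¹) unifSquare := integrable_const _
  have hmem : ∀ᵐ p ∂unifSquare, τ⁻¹ ∈ Set.Ioi x₀ ∧
      τ⁻¹ * (1 + w * (p.1 + p.2)) ∈ Set.Ioi x₀ ∧ τ⁻¹ * (1 + -w * (p.1 + p.2)) ∈ Set.Ioi x₀ ∧
      τ⁻¹ ≤ τ⁻¹ * (1 + w * (p.1 + p.2)) ∧ τ⁻¹ * (1 + -w * (p.1 + p.2)) ≤ τ⁻¹ := by
    filter_upwards [ae_mem_unifSquare] with p hp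
    have h1 : τ⁻¹ * (1 - 2 * w) ≤ τ⁻¹ * (1 + -w * (p.1 + p.2)) := by
      gcongr
      nlinarith [hp.2]
    have h2 : τ⁻¹ * (1 + -w * (p.1 + p.2)) ≤ τ⁻¹ :=
      mul_le_of_le_one_right hτ'.le (by nlinarith [hp.1])
    have h3 : τ⁻¹ ≤ τ⁻¹ * (1 + w * (p.1 + p.2)) :=
      le_mul_of_one_le_right hτ'.le (by nlinarith [hp.1])
    exact ⟨by simp only [Set.mem_Ioi]; linarith, by simp only [Set.mem_Ioi]; linarith,
      by simp only [Set.mem_Ioi]; linarith, h3, h2⟩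
  rw [← e1, ← e2, ← hc, Set.mem_uIcc]
  rcases hmono with hm | hm
  · right
    constructor
    · refine integral_mono_ae i2 ic ?_
      filter_upwards [hmem] with p hp using hm hp.2.2.1 hp.1 hp.2.2.2.2
    · refine integral_mono_ae ic i1 ?_
      filter_upwards [hmem] with p hp using hm hp.1 hp.2.1 hp.2.2.2.1
  · left
    constructor
    · refine integral_mono_ae i1 ic ?_
      filter_upwards [hmem] with p hp using hm hp.1 hp.2.1 hp.2.2.2.1
    · refine integral_mono_ae ic i2 ?_
      filter_upwards [hmem] with p hp using hm hp.2.2.1 hp.1 hp.2.2.2.2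

theorem stmt18 (μ : Measure ℝ) [IsProbabilityMeasure μ] (k : ℝ)
    (hk : 0 < k) (hk2 : k < 2) (hk1 : k ≠ 1)
    (hsign : ∃ δ > 0,
      (∀ t ∈ Set.Ioo (0 : ℝ) δ, 0 < (charFun' μ t).im) ∨
      (∀ t ∈ Set.Ioo (0 : ℝ) δ, (charFun' μ t).im < 0))
    (hrv : ∀ l : ℝ, 0 < l →
      Tendsto (fun t : ℝ => (charFun' μ (l * t)).im / (charFun' μ t).im)
        (nhdsWithin 0 (Set.Ioi 0)) (nhds (l ^ k)))
    (hmono : ∃ x₀ > (0 : ℝ),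
      MonotoneOn (tailDiff μ) (Set.Ioi x₀) ∨ AntitoneOn (tailDiff μ) (Set.Ioi x₀)) :
    Tendsto (fun x : ℝ =>
        tailDiff μ x * (Real.Gamma (1 - k) * Real.sin (Real.pi * k / 2)) /
          (charFun' μ (1 / x)).im)
      atTop (nhds 1) := by
  simp only [charFun'_im] at hsign hrv ⊢
  obtain ⟨x₀, -, hmono⟩ := hmono
  obtain ⟨δ, hδ, hne⟩ : ∃ δ > 0, ∀ t ∈ Set.Ioo (0 : ℝ) δ, ∫ x, Real.sin (t * x) ∂μ ≠ 0 := by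
    obtain ⟨δ, hδ, h | h⟩ := hsign
    · exact ⟨δ, hδ, fun t ht => (h t ht).ne'⟩
    · exact ⟨δ, hδ, fun t ht => (h t ht).ne⟩
  obtain ⟨hC0, hC⟩ := gamma_sin_constant hk hk2 hk1
  set C := Real.Gamma (1 - k) * Real.sin (Real.pi * k / 2)
  set v : ℝ → ℝ := fun t => ∫ x, Real.sin (t * x) ∂μ with hv
  set M : ℝ → ℝ := fun w => 2 / Real.pi * ∫ t in Set.Ioi 0, t ^ k * (smoothCos w t / t) with hM
  have hMlim : Tendsto M (nhdsWithin 0 {0}ᶜ) (nhds C⁻¹) := by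
    rw [← hC]
    refine (((tendsto_second_difference_rpow (2 - k)).const_mul _).const_mul _).congr' ?_
    have h1 : ∀ᶠ w in nhds (0 : ℝ), |w| < 1 / 2 :=
      (continuous_abs.tendsto' (0 : ℝ) 0 abs_zero).eventually (gt_mem_nhds (by norm_num))
    filter_upwards [self_mem_nhdsWithin, nhdsWithin_le_nhds h1] with w hw hw2
    simp only [hM]
    rw [integral_rpow_mul_smoothCos hk hk2 hw hw2]
  have hmain : Tendsto (fun τ => tailDiff μ τ⁻¹ / v τ) (nhdsWithin 0 (Set.Ioi 0)) (nhds C⁻¹) := by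
    rw [Metric.tendsto_nhds]
    intro ε hε
    have hball := hMlim (Metric.ball_mem_nhds C⁻¹ hε)
    obtain ⟨w, hw, hw2, hw3, hw4⟩ : ∃ w > 0, w < 1 / 2 ∧ M w ∈ Metric.ball C⁻¹ ε ∧
        M (-w) ∈ Metric.ball C⁻¹ ε := by
      obtain ⟨r, hr, hsub⟩ := Metric.mem_nhdsWithin_iff.1 hball
      have h0 : 0 < min r (1 / 2) := lt_min hr (by norm_num)
      have h1 := min_le_left r (1 / 2)
      have h2 := min_le_right r (1 / 2)
      refine ⟨min r (1 / 2) / 2, by positivity, by linarith, hsub ⟨?_, ?_⟩, hsub ⟨?_, ?_⟩⟩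
      · rw [mem_ball_zero_iff, Real.norm_of_nonneg (by positivity)]
        linarith
      · exact (by positivity : min r (1 / 2) / 2 ≠ 0)
      · rw [mem_ball_zero_iff, norm_neg, Real.norm_of_nonneg (by positivity)]
        linarith
      · exact neg_ne_zero.2 (by positivity : min r (1 / 2) / 2 ≠ 0)
    have t1 := tendsto_integral_smoothSign_div μ hw.ne' hk hk2 hδ hne hrv
    have t2 := tendsto_integral_smoothSign_div μ (neg_ne_zero.2 hw.ne') hk hk2 hδ hne hrv
    have hfar : ∀ᶠ τ in nhdsWithin (0 : ℝ) (Set.Ioi 0), x₀ < τ⁻¹ * (1 - 2 * w) :=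
      (tendsto_inv_nhdsGT_zero.atTop_mul_const (by linarith)).eventually_gt_atTop x₀
    filter_upwards [t1 (Metric.isOpen_ball.mem_nhds hw3), t2 (Metric.isOpen_ball.mem_nhds hw4),
      hfar, self_mem_nhdsWithin] with τ h1 h2 h3 hτ
    have hmem := tailDiff_mem_uIcc_of_monotoneOn μ hmono hw hτ h3
    rw [← segment_eq_uIcc] at hmem
    obtain ⟨a, b, ha, hb, hab, hK⟩ := hmem
    have hcv := (convex_ball C⁻¹ ε) h1 h2 ha hb hab
    rw [← Metric.mem_ball]
    convert hcv using 1
    rw [← hK]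
    simp only [smul_eq_mul]
    ring
  have hinv : Tendsto (fun x : ℝ => 1 / x) atTop (nhdsWithin 0 (Set.Ioi 0)) := by
    simpa using tendsto_inv_atTop_nhdsGT_zero (𝕜 := ℝ)
  have h := (hmain.comp hinv).mul_const C
  rw [inv_mul_cancel₀ hC0] at h
  refine h.congr fun x => ?_
  simp only [Function.comp_apply, one_div, inv_inv, hv]
  ring
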